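/- Let (X, 𝓑, μ, f) be a dissipative system of bounded distortion generated by W, with f bijective and both f and f⁻¹ satisfying condition (⋆), and let 1 ≤ p < ∞. Then the composition operator T_f on L^p(X, μ) has the shadowing property if and only if at least one of the following three conditions holds: (𝓗𝓒) limsup_{n→∞} sup_{k∈ℤ} (μ(f^k(W))/μ(f^{k+n}(W)))^{1/n} < 1; (𝓗𝓓) liminf_{n→∞} inf_{k∈ℤ} (μ(f^k(W))/μ(f^{k+n}(W)))^{1/n} > 1; (𝓖𝓗) limsup_{n→∞} sup_{k≤0} (μ(f^{k−n}(W))/μ(f^k(W)))^{1/n} < 1 and liminf_{n→∞} inf_{k≥0} (μ(f^k(W))/μ(f^{k+n}(W)))^{1/n} > 1. -/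

import Mathlib

open MeasureTheory Filter Set Function Topology ENNReal

noncomputable section

namespace GHShadow

/-- The shadowing property for an invertible bounded linear operator. -/
def HasShadowing {E : Type*} [NormedAddCommGroup E] [NormedSpace ℝ E]
    (T : E ≃L[ℝ] E) : Prop :=
  ∀ ε : ℝ, 0 < ε → ∃ δ : ℝ, 0 < δ ∧ ∀ x : ℤ → E,
    (∀ n : ℤ, ‖T (x n) - x (n + 1)‖ ≤ δ) →
      ∃ y : E, ∀ n : ℤ, ‖(T ^ n) y - x n‖ < ε

/-- `lim ‖Tⁿ‖^{1/n}` exists and is `< 1`. -/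
def SpectralRadiusLtOne {E : Type*} [NormedAddCommGroup E] [NormedSpace ℝ E]
    (T : E →L[ℝ] E) : Prop :=
  ∃ r : ℝ, r < 1 ∧ Tendsto (fun n : ℕ => ‖T ^ n‖ ^ (1 / (n : ℝ))) atTop (nhds r)

/-- The restriction of `T` to `M` has spectral radius `< 1`
(equivalently, is a proper contraction in an equivalent norm). -/
def ContractsOn {E : Type*} [NormedAddCommGroup E] [NormedSpace ℝ E]
    (T : E ≃L[ℝ] E) (M : Submodule ℝ E) : Prop :=
  ∃ C : ℝ, 0 < C ∧ ∃ t : ℝ, 0 < t ∧ t < 1 ∧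
    ∀ n : ℕ, ∀ x ∈ M, ‖(T ^ n) x‖ ≤ C * t ^ n * ‖x‖

def GeneralizedHyperbolic {E : Type*} [NormedAddCommGroup E] [NormedSpace ℝ E]
    (T : E ≃L[ℝ] E) : Prop :=
  ∃ M N : Submodule ℝ E, IsClosed (M : Set E) ∧ IsClosed (N : Set E) ∧
    IsCompl M N ∧ (∀ x ∈ M, T x ∈ M) ∧ (∀ x ∈ N, T.symm x ∈ N) ∧
    ContractsOn T M ∧ ContractsOn T.symm N

variable {X : Type*} [MeasurableSpace X]

/-- image of `B` under the `k`-th iterate of the invertible map `f`. -/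
def img (f : Equiv.Perm X) (k : ℤ) (B : Set X) : Set X := ⇑(f ^ k) '' B

/-- `(X, 𝓑, μ, f)` is a dissipative system generated by `W`. -/
structure IsDissipative (μ : Measure X) (f : Equiv.Perm X) (W : Set X) : Prop where
  sigmaFin : SigmaFinite μ
  meas_f : Measurable f
  meas_symm : Measurable f.symm
  meas_W : MeasurableSet W
  pos : 0 < μ W
  fin : μ W < ⊤
  disj : Pairwise fun k l : ℤ => Disjoint (img f k W) (img f l W)
  cover : (⋃ k : ℤ, img f k W) = univ

/-- `f` is of bounded distortion on `W` with constant `K`. -/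
def BoundedDistortion (μ : Measure X) (f : Equiv.Perm X) (W : Set X) (K : ℝ≥0∞) : Prop :=
  ∀ k : ℤ, ∀ B : Set X, MeasurableSet B → B ⊆ W →
    (1 / K) * (μ (img f k W) * μ B) ≤ μ (img f k B) * μ W ∧
      μ (img f k B) * μ W ≤ K * (μ (img f k W) * μ B)

/-- condition (⋆) for a transformation `g`. -/
def CondStar (μ : Measure X) (g : X → X) : Prop :=
  ∃ c : ℝ≥0∞, 0 < c ∧ c ≠ ⊤ ∧ ∀ B : Set X, MeasurableSet B → μ (g ⁻¹' B) ≤ c * μ B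

/-- condition 𝓗𝓒. -/
def CondHC (μ : Measure X) (f : Equiv.Perm X) (W : Set X) : Prop :=
  limsup (fun n : ℕ =>
    ⨆ k : ℤ, (μ (img f k W) / μ (img f (k + (n : ℤ)) W)) ^ (1 / (n : ℝ))) atTop < 1

/-- condition 𝓗𝓓. -/
def CondHD (μ : Measure X) (f : Equiv.Perm X) (W : Set X) : Prop :=
  1 < liminf (fun n : ℕ =>
    ⨅ k : ℤ, (μ (img f k W) / μ (img f (k + (n : ℤ)) W)) ^ (1 / (n : ℝ))) atTop

/-- condition 𝓖𝓗. -/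
def CondGH (μ : Measure X) (f : Equiv.Perm X) (W : Set X) : Prop :=
  limsup (fun n : ℕ =>
      ⨆ m : ℕ, (μ (img f (-(m : ℤ) - (n : ℤ)) W) / μ (img f (-(m : ℤ)) W)) ^ (1 / (n : ℝ)))
      atTop < 1 ∧
  1 < liminf (fun n : ℕ =>
      ⨅ m : ℕ, (μ (img f (m : ℤ) W) / μ (img f ((m : ℤ) + (n : ℤ)) W)) ^ (1 / (n : ℝ))) atTop

/-- `T` represents the composition operator `φ ↦ φ ∘ f` on `L^p(X,μ)`. -/
def RepsComp (μ : Measure X) (p : ℝ≥0∞) [Fact (1 ≤ p)] (f : X → X)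
    (T : Lp ℝ p μ ≃L[ℝ] Lp ℝ p μ) : Prop :=
  ∀ φ : Lp ℝ p μ, ⇑(T φ) =ᵐ[μ] fun x => (φ : X → ℝ) (f x)


open scoped NNReal

/-- Uniform exponential decay of `a` in the direction `σ`, starting from any index in `S`. -/
def ExpDecay (a : ℤ → ℝ≥0) (σ : ℤ) (S : Set ℤ) : Prop :=
  ∃ C t : ℝ≥0, t < 1 ∧ ∀ n : ℕ, ∀ k ∈ S, a (k + σ * n) ≤ C * t ^ n * a k

theorem limsup_iSup_root_lt_one_iff {ι : Type*} (b : ℕ → ι → ℝ≥0) (c : ℝ≥0)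
    (hb : ∀ n i, b n i ≤ c ^ n) :
    limsup (fun n : ℕ => ⨆ i, (b n i : ℝ≥0∞) ^ (1 / (n : ℝ))) atTop < 1 ↔
      ∃ C t : ℝ≥0, t < 1 ∧ ∀ n i, b n i ≤ C * t ^ n := by
  constructor
  · intro h
    obtain ⟨t, ht, ht1⟩ := ENNReal.lt_iff_exists_nnreal_btwn.1 h
    have ht1' : t < 1 := by exact_mod_cast ht1
    have ht0 : 0 < t := by
      have : (0 : ℝ≥0∞) < t := lt_of_le_of_lt zero_le ht
      exact_mod_cast this
    obtain ⟨N, hN⟩ := eventually_atTop.1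
      ((eventually_lt_of_limsup_lt ht).and (eventually_gt_atTop 0))
    refine ⟨1 + (max 1 c) ^ N / t ^ N, t, ht1', fun n i => ?_⟩
    rcases le_or_gt N n with hn | hn
    · obtain ⟨h1, h2⟩ := hN n hn
      have h3 : (b n i : ℝ≥0∞) ^ (1 / (n : ℝ)) ≤ t :=
        (le_iSup (fun i => (b n i : ℝ≥0∞) ^ (1 / (n : ℝ))) i).trans h1.le
      rw [one_div, ENNReal.rpow_inv_le_iff (by exact_mod_cast h2), ENNReal.rpow_natCast] at h3
      have h4 : b n i ≤ t ^ n := by exact_mod_cast h3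
      refine h4.trans (le_mul_of_one_le_left zero_le (le_add_of_nonneg_right zero_le))
    · calc b n i ≤ c ^ n := hb n i
        _ ≤ (max 1 c) ^ n := by gcongr; exact le_max_right _ _
        _ ≤ (max 1 c) ^ N := pow_le_pow_right₀ (le_max_left _ _) hn.le
        _ = (max 1 c) ^ N / t ^ N * t ^ N := by field_simp
        _ ≤ (1 + (max 1 c) ^ N / t ^ N) * t ^ n := by
          gcongr ?_ * ?_
          · exact le_add_of_nonneg_left zero_le
          · exact pow_le_pow_of_le_one zero_le ht1'.le hn.le
  · rintro ⟨C, t, ht, h⟩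
    obtain ⟨r, htr, hr⟩ := exists_between ht
    have hr0 : 0 < r := lt_of_le_of_lt zero_le htr
    have hlim : Tendsto (fun n : ℕ => C * (t / r) ^ n) atTop (𝓝 (C * 0)) :=
      (tendsto_pow_atTop_nhds_zero_of_lt_one zero_le ((div_lt_one hr0).2 htr)).const_mul C
    have hev := hlim.eventually (gt_mem_nhds (show C * 0 < 1 by simp))
    refine lt_of_le_of_lt (limsup_le_of_le (h := ?_)) (show (r : ℝ≥0∞) < 1 by exact_mod_cast hr)
    filter_upwards [hev, eventually_gt_atTop 0] with n hn hn0
    refine iSup_le fun i => ?_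
    rw [one_div, ENNReal.rpow_inv_le_iff (by exact_mod_cast hn0), ENNReal.rpow_natCast]
    have : b n i ≤ r ^ n := by
      calc b n i ≤ C * t ^ n := h n i
        _ = C * (t / r) ^ n * r ^ n := by
          rw [mul_assoc, ← mul_pow, div_mul_cancel₀ _ hr0.ne']
        _ ≤ 1 * r ^ n := by gcongr
        _ = r ^ n := one_mul _
    exact_mod_cast this

theorem one_lt_liminf_iInf_root_iff {ι : Type*} (b : ℕ → ι → ℝ≥0∞) :
    1 < liminf (fun n : ℕ => ⨅ i, b n i ^ (1 / (n : ℝ))) atTop ↔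
      limsup (fun n : ℕ => ⨆ i, (b n i)⁻¹ ^ (1 / (n : ℝ))) atTop < 1 := by
  rw [← ENNReal.inv_lt_one, ENNReal.inv_liminf]
  simp only [ENNReal.inv_iInf, ENNReal.inv_rpow]

theorem ExpDecay.mono {a : ℤ → ℝ≥0} {σ : ℤ} {S S' : Set ℤ} (h : ExpDecay a σ S) (hS : S' ⊆ S) :
    ExpDecay a σ S' := by
  obtain ⟨C, t, ht, h⟩ := h
  exact ⟨C, t, ht, fun n k hk => h n k (hS hk)⟩

theorem ExpDecay.of_shift {a : ℤ → ℝ≥0} {σ N : ℤ} {S S' : Set ℤ} {M : ℝ≥0} (h : ExpDecay a σ S)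
    (hS : ∀ k ∈ S', k + N ∈ S) (h₁ : ∀ k, a k ≤ M * a (k + N)) (h₂ : ∀ k, a (k + N) ≤ M * a k) :
    ExpDecay a σ S' := by
  obtain ⟨C, t, ht, h⟩ := h
  refine ⟨M * C * M, t, ht, fun n k hk => ?_⟩
  calc a (k + σ * n) ≤ M * a (k + N + σ * n) := by
        have := h₁ (k + σ * n)
        rwa [add_right_comm] at this
    _ ≤ M * (C * t ^ n * (M * a k)) := by
        gcongr
        exact (h n _ (hS k hk)).trans (by gcongr; exact h₂ k)
    _ = M * C * M * t ^ n * a k := by ring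

theorem ExpDecay.of_rpow {a : ℤ → ℝ≥0} (ha : ∀ k, 0 < a k) {σ : ℤ} {S : Set ℤ} {q C t : ℝ}
    (hq : 0 < q) (hC : 0 ≤ C) (ht : 0 ≤ t) (ht1 : t < 1)
    (h : ∀ n : ℕ, ∀ k ∈ S, (a k : ℝ) ^ (-(1 / q)) ≤ C * t ^ n * (a (k + σ * n) : ℝ) ^ (-(1 / q))) :
    ExpDecay a σ S := by
  lift C to ℝ≥0 using hC
  lift t to ℝ≥0 using ht
  refine ⟨C ^ q, t ^ q, NNReal.rpow_lt_one (by exact_mod_cast ht1) hq, fun n k hk => ?_⟩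
  have h1 := h n k hk
  have h2 : (a k) ^ (-(1 / q)) ≤ C * t ^ n * (a (k + σ * n)) ^ (-(1 / q)) := by exact_mod_cast h1
  have h3 : (a (k + σ * n)) ^ (1 / q) ≤ C * t ^ n * (a k) ^ (1 / q) := by
    have e1 := NNReal.rpow_pos (p := 1 / q) (ha k)
    have e2 := NNReal.rpow_pos (p := 1 / q) (ha (k + σ * n))
    rw [NNReal.rpow_neg, NNReal.rpow_neg] at h2
    rw [← div_eq_mul_inv, le_div_iff₀ e2, inv_mul_le_iff₀ e1] at h2
    rwa [mul_comm ((a k) ^ (1 / q))] at h2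
  have h4 := NNReal.rpow_le_rpow h3 hq.le
  rw [NNReal.mul_rpow, NNReal.mul_rpow, ← NNReal.rpow_mul, ← NNReal.rpow_mul,
    one_div_mul_cancel hq.ne', NNReal.rpow_one, NNReal.rpow_one, ← NNReal.rpow_natCast,
    ← NNReal.rpow_mul, mul_comm (n : ℝ), NNReal.rpow_mul, NNReal.rpow_natCast] at h4
  exact h4

theorem exists_int_primitive (g : ℤ → ℝ) : ∃ s : ℤ → ℝ, ∀ n, s (n + 1) = s n + g n := by
  refine ⟨fun n => ∑ i ∈ Finset.range n.toNat, g i -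
    ∑ i ∈ Finset.range (-n).toNat, g (-(i : ℤ) - 1), fun n => ?_⟩
  obtain ⟨m, rfl | rfl⟩ : ∃ m : ℕ, n = m ∨ n = -(m : ℤ) - 1 := by
    rcases le_or_gt 0 n with h | h
    · exact ⟨n.toNat, Or.inl (by omega)⟩
    · exact ⟨(-n - 1).toNat, Or.inr (by omega)⟩
  · have h1 : ((m : ℤ) + 1).toNat = m + 1 := by omega
    have h2 : (-((m : ℤ) + 1)).toNat = 0 := by omega
    have h3 : (-(m : ℤ)).toNat = 0 := by omega
    simp only [h1, h2, h3, Int.toNat_natCast, Finset.sum_range_succ]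
    simp
  · have h1 : (-(m : ℤ) - 1 + 1).toNat = 0 := by omega
    have h2 : (-(-(m : ℤ) - 1 + 1)).toNat = m := by omega
    have h3 : (-(m : ℤ) - 1).toNat = 0 := by omega
    have h4 : (-(-(m : ℤ) - 1)).toNat = m + 1 := by omega
    simp only [h1, h2, h3, h4, Finset.sum_range_succ]
    simp

theorem primitive_growth {r w : ℤ → ℝ} {L : ℝ} (hL : 0 ≤ L) (hw : ∀ n, 0 < w n)
    (hr : ∀ n, r (n + 1) = r n + w (n + 1)) (hb : ∀ n, |r n| ≤ L * w n)
    {m : ℤ} (hm : 0 ≤ r (m - 1)) (i : ℕ) :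
    w m ≤ (L + 1) * (L / (L + 1)) ^ i * w (m + i) := by
  have hL1 : 0 < L + 1 := by linarith
  have step : ∀ j, r j ≤ L / (L + 1) * r (j + 1) := fun j => by
    have h1 := hr j
    have h2 := (le_abs_self _).trans (hb (j + 1))
    rw [div_mul_eq_mul_div, le_div_iff₀ hL1]
    nlinarith [hw (j + 1)]
  have iter : ∀ i : ℕ, r m ≤ (L / (L + 1)) ^ i * r (m + i) := fun i => by
    induction i with
    | zero => simp
    | succ i ih =>
      refine ih.trans ?_
      rw [pow_succ, mul_assoc, Nat.cast_succ, ← add_assoc]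
      gcongr
      exact step _
  have h0 : r m = r (m - 1) + w m := by simpa using hr (m - 1)
  have h1 := (le_abs_self _).trans (hb (m + i))
  calc w m ≤ r m := by linarith
    _ ≤ (L / (L + 1)) ^ i * r (m + i) := iter i
    _ ≤ (L / (L + 1)) ^ i * ((L + 1) * w (m + i)) := by
      gcongr
      linarith [hw (m + i)]
    _ = _ := by ring

theorem primitive_decay {r w : ℤ → ℝ} {L : ℝ} (hL : 0 ≤ L)
    (hr : ∀ n, r (n + 1) = r n + w (n + 1)) (hb : ∀ n, |r n| ≤ L * w n)
    {m : ℤ} (hm : r m ≤ 0) (i : ℕ) :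
    w m ≤ (L + 1) * (L / (L + 1)) ^ i * w (m - i) := by
  have hL1 : 0 < L + 1 := by linarith
  have step : ∀ j, -r (j + 1) ≤ L / (L + 1) * -r j := fun j => by
    have h1 := hr j
    have h2 := (neg_le_abs _).trans (hb (j + 1))
    rw [div_mul_eq_mul_div, le_div_iff₀ hL1]
    nlinarith
  have iter : ∀ i : ℕ, -r (m - 1) ≤ (L / (L + 1)) ^ i * -r (m - i - 1) := fun i => by
    induction i with
    | zero => simp
    | succ i ih =>
      refine ih.trans ?_
      rw [pow_succ, mul_assoc]
      gcongr
      have := step (m - (i + 1 : ℕ) - 1)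
      rwa [show m - ((i + 1 : ℕ) : ℤ) - 1 + 1 = m - i - 1 by push_cast; ring] at this
  have h0 : r m = r (m - 1) + w m := by simpa using hr (m - 1)
  have h1 := (neg_le_abs _).trans (hb (m - i))
  have h2 : r (m - i) = r (m - i - 1) + w (m - i) := by simpa using hr (m - i - 1)
  calc w m ≤ -r (m - 1) := by linarith
    _ ≤ (L / (L + 1)) ^ i * -r (m - i - 1) := iter i
    _ ≤ (L / (L + 1)) ^ i * ((L + 1) * w (m - i)) := by
      gcongr
      linarith
    _ = _ := by ring

/-- A positive function on `ℤ` that dominates one of its primitives grows exponentially, decays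
exponentially, or grows exponentially in both directions. -/
theorem primitive_trichotomy {r w : ℤ → ℝ} {L : ℝ} (hL : 0 ≤ L) (hw : ∀ n, 0 < w n)
    (hr : ∀ n, r (n + 1) = r n + w (n + 1)) (hb : ∀ n, |r n| ≤ L * w n) :
    ∃ C t : ℝ, 0 ≤ C ∧ 0 ≤ t ∧ t < 1 ∧
      ((∀ m, ∀ i : ℕ, w m ≤ C * t ^ i * w (m + i)) ∨
        (∀ m, ∀ i : ℕ, w m ≤ C * t ^ i * w (m - i)) ∨
        ∃ m₁ m₂ : ℤ, (∀ m ≤ m₁, ∀ i : ℕ, w m ≤ C * t ^ i * w (m - i)) ∧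
          ∀ m ≥ m₂, ∀ i : ℕ, w m ≤ C * t ^ i * w (m + i)) := by
  have hL1 : 0 < L + 1 := by linarith
  refine ⟨L + 1, L / (L + 1), by positivity, by positivity,
    (div_lt_one hL1).2 (by linarith), ?_⟩
  by_cases h₁ : ∀ m, 0 ≤ r m
  · exact Or.inl fun m i => primitive_growth hL hw hr hb (h₁ _) i
  by_cases h₂ : ∀ m, r m ≤ 0
  · exact Or.inr (Or.inl fun m i => primitive_decay hL hr hb (h₂ _) i)
  push Not at h₁ h₂
  obtain ⟨m₁, h₁⟩ := h₁
  obtain ⟨m₂, h₂⟩ := h₂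
  have hmono : Monotone r := monotone_int_of_le_succ fun n => by linarith [hr n, hw (n + 1)]
  exact Or.inr (Or.inr ⟨m₁, m₂ + 1,
    fun m hm i => primitive_decay hL hr hb ((hmono hm).trans h₁.le) i,
    fun m hm i => primitive_growth hL hw hr hb (h₂.le.trans (hmono (by linarith))) i⟩)

theorem hasShadowing_of_splitting {E : Type*} [NormedAddCommGroup E] [NormedSpace ℝ E]
    [CompleteSpace E] (T : E ≃L[ℝ] E) (P : E → E) {C₁ t₁ C₂ t₂ : ℝ}
    (hC₁ : 0 ≤ C₁) (ht₁ : 0 ≤ t₁) (ht₁' : t₁ < 1) (hC₂ : 0 ≤ C₂) (ht₂ : 0 ≤ t₂) (ht₂' : t₂ < 1)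
    (h₁ : ∀ (n : ℕ) (x : E), ‖(T ^ (n : ℤ)) (P x)‖ ≤ C₁ * t₁ ^ n * ‖x‖)
    (h₂ : ∀ (n : ℕ) (x : E), ‖(T ^ (-(n : ℤ))) (x - P x)‖ ≤ C₂ * t₂ ^ n * ‖x‖) :
    HasShadowing T := by
  intro ε hε
  set A := C₁ * (1 - t₁)⁻¹ + C₂ * (1 - t₂)⁻¹ with hA
  have hA0 : 0 ≤ A := by
    have := sub_pos.2 ht₁'
    have := sub_pos.2 ht₂'
    positivity
  refine ⟨ε / (2 * (A + 1)), by positivity, fun x hx => ?_⟩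
  set δ := ε / (2 * (A + 1))
  have hδ : 0 ≤ δ := by positivity
  set z : ℤ → E := fun n => x (n + 1) - T (x n) with hz
  have hzδ : ∀ n, ‖z n‖ ≤ δ := fun n => by rw [hz, norm_sub_rev]; exact hx n
  set u : ℤ → ℕ → E := fun n j => (T ^ (j : ℤ)) (P (z (n - 1 - j))) with hu
  set v : ℤ → ℕ → E := fun n j => (T ^ (-(j : ℤ))) (z (n - 1 + j) - P (z (n - 1 + j))) with hv
  have hub : ∀ n j, ‖u n j‖ ≤ C₁ * δ * t₁ ^ j := fun n j => by
    refine (h₁ _ _).trans ?_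
    calc C₁ * t₁ ^ j * ‖z (n - 1 - j)‖ ≤ C₁ * t₁ ^ j * δ := by gcongr; exact hzδ _
      _ = _ := by ring
  have hvb : ∀ n j, ‖v n j‖ ≤ C₂ * δ * t₂ ^ j := fun n j => by
    refine (h₂ _ _).trans ?_
    calc C₂ * t₂ ^ j * ‖z (n - 1 + j)‖ ≤ C₂ * t₂ ^ j * δ := by gcongr; exact hzδ _
      _ = _ := by ring
  have hg₁ := (hasSum_geometric_of_lt_one ht₁ ht₁').mul_left (C₁ * δ)
  have hg₂ := (hasSum_geometric_of_lt_one ht₂ ht₂').mul_left (C₂ * δ)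
  have hus : ∀ n, Summable (u n) := fun n => .of_norm_bounded hg₁.summable (hub n)
  have hvs : ∀ n, Summable (v n) := fun n => .of_norm_bounded hg₂.summable (hvb n)
  have hTu : ∀ n j, T (u n j) = u (n + 1) (j + 1) := fun n j => by
    simp only [hu, Nat.cast_succ, add_comm (j : ℤ) 1, zpow_one_add]
    rw [show n + 1 - 1 - (1 + (j : ℤ)) = n - 1 - j by ring]
    rfl
  have hTv : ∀ n j, T (v n (j + 1)) = v (n + 1) j := fun n j => by
    simp only [hv]
    rw [show n - 1 + ((j + 1 : ℕ) : ℤ) = n + 1 - 1 + j by push_cast; ring,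
      show -(j : ℤ) = 1 + -((j + 1 : ℕ) : ℤ) by push_cast; ring, zpow_one_add]
    rfl
  set e : ℤ → E := fun n => ∑' j, u n j - ∑' j, v n (j + 1) with he
  have hvs' : ∀ n, Summable fun j => v n (j + 1) := fun n => (summable_nat_add_iff 1).2 (hvs n)
  have hstep : ∀ n, e (n + 1) = T (e n) + z n := fun n => by
    simp only [he, map_sub]
    rw [T.map_tsum, T.map_tsum]
    simp only [hTu, hTv]
    rw [(hus (n + 1)).tsum_eq_zero_add, (hvs (n + 1)).tsum_eq_zero_add]
    have hu0 : u (n + 1) 0 = P (z n) := by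
      simp only [hu, Nat.cast_zero, zpow_zero, sub_zero, add_sub_cancel_right]
      rfl
    have hv0 : v (n + 1) 0 = z n - P (z n) := by
      simp only [hv, Nat.cast_zero, neg_zero, zpow_zero, add_zero, add_sub_cancel_right]
      rfl
    rw [hu0, hv0]
    abel
  have heb : ∀ n, ‖e n‖ ≤ A * δ := fun n => by
    have b₁ : ‖∑' j, u n j‖ ≤ C₁ * δ * (1 - t₁)⁻¹ := tsum_of_norm_bounded hg₁ (hub n)
    have b₂ : ‖∑' j, v n (j + 1)‖ ≤ C₂ * δ * (1 - t₂)⁻¹ := by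
      refine tsum_of_norm_bounded hg₂ fun j => (hvb n (j + 1)).trans ?_
      gcongr ?_ * ?_
      exact pow_le_pow_of_le_one ht₂ ht₂'.le (Nat.le_succ j)
    calc ‖e n‖ ≤ _ := norm_sub_le _ _
      _ ≤ _ := add_le_add b₁ b₂
      _ = A * δ := by rw [hA]; ring
  have horbit : ∀ n : ℤ, x n - e n = (T ^ n) (x 0 - e 0) := fun n => by
    have hT : ∀ n, x (n + 1) - e (n + 1) = T (x n - e n) := fun n => by
      rw [hstep, map_sub T (x n)]
      simp only [hz]
      abel
    induction n with
    | zero => rfl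
    | succ n ih =>
      rw [hT, ih, add_comm, zpow_one_add]
      rfl
    | pred n ih =>
      apply T.injective
      rw [← hT, sub_add_cancel, ih]
      conv_lhs => rw [show -(n : ℤ) = 1 + (-(n : ℤ) - 1) by ring, zpow_one_add]
      rfl
  refine ⟨x 0 - e 0, fun n => ?_⟩
  rw [← horbit, sub_sub_cancel_left, norm_neg]
  refine (heb n).trans_lt ?_
  rw [show A * δ = ε * (A / (2 * (A + 1))) by simp only [δ]; ring]
  refine mul_lt_of_lt_one_right hε ((div_lt_one (by positivity)).2 (by linarith))

variable {μ : Measure X} {f : Equiv.Perm X} {W : Set X}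

theorem img_eq_preimage {Y : Type*} (f : Equiv.Perm Y) (k : ℤ) (B : Set Y) :
    img f k B = ⇑(f ^ (-k)) ⁻¹' B := by
  rw [img, Equiv.image_eq_preimage_symm, zpow_neg]
  rfl

theorem preimage_zpow_img {Y : Type*} (f : Equiv.Perm Y) (n k : ℤ) (B : Set Y) :
    ⇑(f ^ n) ⁻¹' img f k B = img f (k - n) B := by
  rw [img_eq_preimage, img_eq_preimage, ← preimage_comp, ← Equiv.Perm.coe_mul, ← zpow_add]
  congr 3
  ring

theorem img_preimage {Y : Type*} (f : Equiv.Perm Y) (k : ℤ) (B : Set Y) :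
    img f k (⇑(f ^ k) ⁻¹' B) = B := by
  rw [img, image_preimage_eq _ (f ^ k).surjective]

theorem quasiMeasurePreserving_of_condStar {g : X → X} (hg : Measurable g) (h : CondStar μ g) :
    Measure.QuasiMeasurePreserving g μ μ := by
  obtain ⟨c, -, -, h⟩ := h
  refine ⟨hg, Measure.AbsolutelyContinuous.mk fun s hs h0 => ?_⟩
  rw [Measure.map_apply hg hs]
  simpa [h0] using h s hs

theorem quasiMeasurePreserving_zpow (h : Measure.QuasiMeasurePreserving f μ μ)
    (h' : Measure.QuasiMeasurePreserving f.symm μ μ) (n : ℤ) :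
    Measure.QuasiMeasurePreserving (⇑(f ^ n)) μ μ := by
  induction n with
  | zero => exact Measure.QuasiMeasurePreserving.id μ
  | succ n ih =>
    rw [zpow_add_one]
    exact ih.comp h
  | pred n ih =>
    rw [zpow_sub_one]
    exact ih.comp h'

theorem RepsComp.zpow {p : ℝ≥0∞} [Fact (1 ≤ p)] {T : Lp ℝ p μ ≃L[ℝ] Lp ℝ p μ}
    (hT : RepsComp μ p f T) (h : Measure.QuasiMeasurePreserving f μ μ)
    (h' : Measure.QuasiMeasurePreserving f.symm μ μ) (n : ℤ) :
    RepsComp μ p (⇑(f ^ n)) (T ^ n) := by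
  have hT' : RepsComp μ p f.symm T.symm := fun φ => by
    have h1 := h'.ae_eq_comp (hT (T.symm φ))
    rw [T.apply_symm_apply] at h1
    filter_upwards [h1] with x hx
    simpa using hx.symm
  induction n with
  | zero => exact fun φ => Eventually.of_forall fun x => rfl
  | succ n ih =>
    intro φ
    have h1 := (ih (T φ)).trans ((quasiMeasurePreserving_zpow h h' n).ae_eq_comp (hT φ))
    rw [zpow_add_one, add_comm, zpow_one_add]
    exact h1
  | pred n ih =>
    intro φ
    have h1 := (ih (T.symm φ)).trans ((quasiMeasurePreserving_zpow h h' (-n)).ae_eq_comp (hT' φ))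
    rw [zpow_sub_one, sub_eq_neg_add, zpow_add, zpow_neg_one]
    exact h1

theorem condStar_bound {σ : ℤ} {c : ℝ≥0∞}
    (h : ∀ B : Set X, MeasurableSet B → μ (⇑(f ^ (-σ)) ⁻¹' B) ≤ c * μ B)
    (hW : ∀ k, MeasurableSet (img f k W)) (n : ℕ) (k : ℤ) :
    μ (img f (k + σ * n) W) ≤ c ^ n * μ (img f k W) := by
  induction n with
  | zero => simp
  | succ n ih =>
    have := h _ (hW (k + σ * n))
    rw [preimage_zpow_img, sub_neg_eq_add] at this
    rw [pow_succ', mul_assoc, Nat.cast_succ, mul_add, mul_one, ← add_assoc]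
    exact this.trans (by gcongr)

theorem IsDissipative.measurable_zpow (hd : IsDissipative μ f W) (n : ℤ) :
    Measurable (⇑(f ^ n)) := by
  induction n with
  | zero => exact measurable_id
  | succ n ih =>
    rw [zpow_add_one]
    exact ih.comp hd.meas_f
  | pred n ih =>
    rw [zpow_sub_one]
    exact ih.comp hd.meas_symm

theorem IsDissipative.measurableSet_img (hd : IsDissipative μ f W) (k : ℤ) {B : Set X}
    (hB : MeasurableSet B) : MeasurableSet (img f k B) := by
  rw [img_eq_preimage]
  exact hd.measurable_zpow _ hB

theorem IsDissipative.measurableSet_biUnion (hd : IsDissipative μ f W) (S : Set ℤ) :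
    MeasurableSet (⋃ k ∈ S, img f k W) :=
  .iUnion fun k => .iUnion fun _ => hd.measurableSet_img k hd.meas_W

theorem IsDissipative.compl_biUnion (hd : IsDissipative μ f W) (S : Set ℤ) :
    (⋃ k ∈ S, img f k W)ᶜ = ⋃ k ∈ Sᶜ, img f k W := by
  ext x
  obtain ⟨l, hl⟩ := mem_iUnion.1 (hd.cover ▸ mem_univ x)
  have key : ∀ k, x ∈ img f k W ↔ k = l := fun k =>
    ⟨fun hk => by_contra fun hne => (hd.disj hne).notMem_of_mem_left hk hl, fun h => h ▸ hl⟩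
  simp only [key, mem_compl_iff, mem_iUnion, exists_prop, not_exists, not_and]
  exact ⟨fun h => ⟨l, fun hl => h l hl rfl, rfl⟩, fun ⟨i, hi, hil⟩ j hj hjl => hi (hil ▸ hjl ▸ hj)⟩

theorem measure_preimage_img_le (hd : IsDissipative μ f W) {K : ℝ≥0∞} (hK0 : 0 < K) (hK : K ≠ ⊤)
    (hbd : BoundedDistortion μ f W K) {n k : ℤ} {D : ℝ≥0∞}
    (hD : μ (img f (k - n) W) ≤ D * μ (img f k W)) {B : Set X} (hB : MeasurableSet B)
    (hBk : B ⊆ img f k W) : μ (⇑(f ^ n) ⁻¹' B) ≤ K * K * D * μ B := by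
  set B' := ⇑(f ^ k) ⁻¹' B with hB'
  have hBB : B = img f k B' := (img_preimage f k B).symm
  have hB'm : MeasurableSet B' := hd.measurable_zpow k hB
  have hB'W : B' ⊆ W := by
    rintro x hx
    obtain ⟨y, hy, hxy⟩ := hBk hx
    exact (f ^ k).injective hxy ▸ hy
  have h1 := (hbd (k - n) B' hB'm hB'W).2
  have h2 := (hbd k B' hB'm hB'W).1
  rw [one_div, ENNReal.inv_mul_le_iff hK0.ne' hK, ← hBB] at h2
  rw [hBB, preimage_zpow_img, ← hBB]
  rw [← ENNReal.mul_le_mul_iff_left hd.pos.ne' hd.fin.ne]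
  calc μ (img f (k - n) B') * μ W ≤ K * (μ (img f (k - n) W) * μ B') := h1
    _ ≤ K * (D * μ (img f k W) * μ B') := by gcongr
    _ = K * D * (μ (img f k W) * μ B') := by ring
    _ ≤ K * D * (K * (μ B * μ W)) := by gcongr
    _ = K * K * D * μ B * μ W := by ring

theorem measure_preimage_le (hd : IsDissipative μ f W) {K : ℝ≥0∞} (hK0 : 0 < K) (hK : K ≠ ⊤)
    (hbd : BoundedDistortion μ f W K) {S : Set ℤ} {n : ℤ} {D : ℝ≥0∞}
    (hD : ∀ k ∈ S, μ (img f (k - n) W) ≤ D * μ (img f k W)) {B : Set X} (hB : MeasurableSet B)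
    (hBS : B ⊆ ⋃ k ∈ S, img f k W) : μ (⇑(f ^ n) ⁻¹' B) ≤ K * K * D * μ B := by
  have hBU : B = ⋃ k : S, B ∩ img f k W := by
    rw [← inter_iUnion, ← biUnion_eq_iUnion S fun k _ => img f k W, inter_eq_left.2 hBS]
  have hm : ∀ k : ℤ, MeasurableSet (B ∩ img f k W) := fun k =>
    hB.inter (hd.measurableSet_img k hd.meas_W)
  have hdisj : Pairwise (Disjoint on fun k : S => B ∩ img f k W) := fun k l hkl =>
    (hd.disj (Subtype.coe_injective.ne hkl)).mono inter_subset_right inter_subset_right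
  calc μ (⇑(f ^ n) ⁻¹' B) = μ (⋃ k : S, ⇑(f ^ n) ⁻¹' (B ∩ img f k W)) := by
        rw [← preimage_iUnion, ← hBU]
    _ ≤ ∑' k : S, μ (⇑(f ^ n) ⁻¹' (B ∩ img f k W)) := measure_iUnion_le _
    _ ≤ ∑' k : S, K * K * D * μ (B ∩ img f k W) := ENNReal.tsum_le_tsum fun k =>
        measure_preimage_img_le hd hK0 hK hbd (hD k k.2) (hm k) inter_subset_right
    _ = K * K * D * μ B := by
        rw [ENNReal.tsum_mul_left, ← measure_iUnion hdisj fun k => hm k, ← hBU]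

theorem eLpNorm_indicator_comp_le (hd : IsDissipative μ f W) {K : ℝ≥0∞} (hK0 : 0 < K) (hK : K ≠ ⊤)
    (hbd : BoundedDistortion μ f W K) {n : ℤ} (hn : Measure.QuasiMeasurePreserving (⇑(f ^ n)) μ μ)
    {S : Set ℤ} {D : ℝ≥0∞} (hD : ∀ k ∈ S, μ (img f (k - n) W) ≤ D * μ (img f k W))
    (p : ℝ≥0∞) {φ : X → ℝ} (hφ : AEStronglyMeasurable φ μ) :
    eLpNorm (((⋃ k ∈ S, img f k W).indicator φ) ∘ ⇑(f ^ n)) p μ ≤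
      (K * K * D) ^ (1 / p).toReal * eLpNorm φ p μ := by
  have hA := hd.measurableSet_biUnion S
  have hle : (μ.map (⇑(f ^ n))).restrict (⋃ k ∈ S, img f k W) ≤ (K * K * D) • μ := by
    refine Measure.le_iff.2 fun B hB => ?_
    rw [Measure.restrict_apply hB, Measure.map_apply hn.measurable (hB.inter hA)]
    refine (measure_preimage_le hd hK0 hK hbd hD (hB.inter hA) inter_subset_right).trans ?_
    rw [Measure.smul_apply, smul_eq_mul]
    gcongr
    exact inter_subset_left
  rw [← eLpNorm_map_measure ((hφ.indicator hA).mono_ac hn.absolutelyContinuous)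
    hn.measurable.aemeasurable, eLpNorm_indicator_eq_eLpNorm_restrict hA]
  exact (eLpNorm_mono_measure _ hle).trans (eLpNorm_smul_measure_le _ _ _ _)

theorem norm_zpow_indicator_le (hd : IsDissipative μ f W) {K : ℝ≥0} (hK0 : 0 < K)
    (hbd : BoundedDistortion μ f W K) {n : ℤ} (hn : Measure.QuasiMeasurePreserving (⇑(f ^ n)) μ μ)
    {S : Set ℤ} {D : ℝ≥0} (hD : ∀ k ∈ S, μ (img f (k - n) W) ≤ D * μ (img f k W))
    {p : ℝ≥0∞} [Fact (1 ≤ p)] {T : Lp ℝ p μ ≃L[ℝ] Lp ℝ p μ} (hT : RepsComp μ p (⇑(f ^ n)) (T ^ n))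
    (φ : Lp ℝ p μ) :
    ‖(T ^ n) (((Lp.memLp φ).indicator (hd.measurableSet_biUnion S)).toLp _)‖ ≤
      ((K * K * D) ^ (1 / p).toReal : ℝ≥0) * ‖φ‖ := by
  have h1 := hn.ae_eq_comp ((Lp.memLp φ).indicator (hd.measurableSet_biUnion S)).coeFn_toLp
  rw [Lp.norm_def, Lp.norm_def, eLpNorm_congr_ae ((hT _).trans h1), ← ENNReal.coe_toReal,
    ← ENNReal.toReal_mul]
  refine ENNReal.toReal_mono (ENNReal.mul_ne_top ENNReal.coe_ne_top (Lp.eLpNorm_ne_top φ)) ?_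
  refine (eLpNorm_indicator_comp_le hd (by exact_mod_cast hK0) ENNReal.coe_ne_top hbd hn hD p
    (Lp.aestronglyMeasurable φ)).trans_eq ?_
  rw [ENNReal.coe_rpow_of_nonneg _ ENNReal.toReal_nonneg]
  push_cast
  rfl

theorem hasShadowing_of_expDecay (hd : IsDissipative μ f W) {K : ℝ≥0} (hK0 : 0 < K)
    (hbd : BoundedDistortion μ f W K) (h : Measure.QuasiMeasurePreserving f μ μ)
    (h' : Measure.QuasiMeasurePreserving f.symm μ μ) {p : ℝ≥0∞} [Fact (1 ≤ p)] (hp : p ≠ ⊤)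
    {T : Lp ℝ p μ ≃L[ℝ] Lp ℝ p μ} (hT : RepsComp μ p f T) {a : ℤ → ℝ≥0}
    (ha : ∀ k, μ (img f k W) = a k) {S : Set ℤ} (h₁ : ExpDecay a (-1) S) (h₂ : ExpDecay a 1 Sᶜ) :
    HasShadowing T := by
  obtain ⟨C₁, t₁, ht₁, h₁⟩ := h₁
  obtain ⟨C₂, t₂, ht₂, h₂⟩ := h₂
  have hp1 : 1 ≤ p := Fact.out
  have hq : 0 < (1 / p).toReal := ENNReal.toReal_pos (by simp [hp]) (by simp; positivity)
  set q := (1 / p).toReal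
  have hroot : ∀ (C t : ℝ≥0) (n : ℕ), (((K * K * (C * t ^ n)) ^ q : ℝ≥0) : ℝ) =
      ((K * K * C) ^ q : ℝ≥0) * ((t ^ q : ℝ≥0) : ℝ) ^ n := fun C t n => by
    rw [← mul_assoc, NNReal.mul_rpow, ← NNReal.rpow_natCast, ← NNReal.rpow_mul, mul_comm _ q,
      NNReal.rpow_mul, NNReal.rpow_natCast]
    push_cast
    rfl
  refine hasShadowing_of_splitting T
    (fun φ => ((Lp.memLp φ).indicator (hd.measurableSet_biUnion S)).toLp _)
    (C₁ := ((K * K * C₁) ^ q : ℝ≥0)) (t₁ := (t₁ ^ q : ℝ≥0)) (C₂ := ((K * K * C₂) ^ q : ℝ≥0))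
    (t₂ := (t₂ ^ q : ℝ≥0)) (NNReal.coe_nonneg _) (NNReal.coe_nonneg _)
    (NNReal.coe_lt_one.2 (NNReal.rpow_lt_one ht₁ hq)) (NNReal.coe_nonneg _) (NNReal.coe_nonneg _)
    (NNReal.coe_lt_one.2 (NNReal.rpow_lt_one ht₂ hq)) (fun n φ => ?_) (fun n φ => ?_)
  · rw [← hroot]
    refine norm_zpow_indicator_le hd hK0 hbd (quasiMeasurePreserving_zpow h h' _)
      (fun k hk => ?_) (hT.zpow h h' _) φ
    rw [ha, ha]
    have := h₁ n k hk
    rw [neg_one_mul, ← sub_eq_add_neg] at this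
    exact_mod_cast this
  · have hsplit : φ - ((Lp.memLp φ).indicator (hd.measurableSet_biUnion S)).toLp _ =
        ((Lp.memLp φ).indicator (hd.measurableSet_biUnion Sᶜ)).toLp _ := by
      rw [sub_eq_iff_eq_add, ← MemLp.toLp_add]
      refine (Lp.toLp_coeFn φ (Lp.memLp φ)).symm.trans ?_
      congr 1
      rw [← hd.compl_biUnion, indicator_compl_add_self]
    rw [← hroot, hsplit]
    refine norm_zpow_indicator_le hd hK0 hbd (quasiMeasurePreserving_zpow h h' _)
      (fun k hk => ?_) (hT.zpow h h' _) φ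
    rw [ha, ha, sub_neg_eq_add]
    have := h₂ n k hk
    rw [one_mul] at this
    exact_mod_cast this

theorem exists_average_bound (hd : IsDissipative μ f W) {K : ℝ≥0} (hK0 : 0 < K)
    (hbd : BoundedDistortion μ f W K) (h : Measure.QuasiMeasurePreserving f μ μ)
    (h' : Measure.QuasiMeasurePreserving f.symm μ μ) {p : ℝ≥0∞} [Fact (1 ≤ p)]
    {T : Lp ℝ p μ ≃L[ℝ] Lp ℝ p μ} (hT : RepsComp μ p f T) {a : ℤ → ℝ≥0}
    (ha : ∀ k, μ (img f k W) = a k) (ha0 : ∀ k, 0 < a k) :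
    ∃ L : ℝ, 0 ≤ L ∧ ∀ y : Lp ℝ p μ, ∃ c : ℝ, ∀ (n : ℤ) (s : ℝ),
      ‖(T ^ n) y - indicatorConstLp p (hd.measurableSet_img (-n) hd.meas_W)
        ((ha (-n)).trans_ne ENNReal.coe_ne_top) s‖ ≤ 1 →
      |s - c| ≤ L * (a (-n) : ℝ) ^ (-(1 / p.toReal)) := by
  have hp1 : 1 ≤ p := Fact.out
  obtain ⟨m, hm⟩ : ∃ m : ℝ≥0, μ W = m := ⟨_, (ENNReal.coe_toNNReal hd.fin.ne).symm⟩
  have hm0 : 0 < m := by exact_mod_cast hm ▸ hd.pos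
  have hfin : IsFiniteMeasure (μ.restrict W) := ⟨by simpa using hd.fin⟩
  set e := 1 / p.toReal with he
  have he' : (1 / p).toReal = e := by simp [he]
  have he0 : 0 ≤ e := by positivity
  refine ⟨((m⁻¹ * ((K * m) ^ e * m ^ (1 - e)) : ℝ≥0) : ℝ), NNReal.coe_nonneg _, fun y =>
    ⟨(m : ℝ)⁻¹ * ∫ x in W, y x ∂μ, fun n s hs => ?_⟩⟩
  set g : X → ℝ := fun x => y x - s with hg
  have hn := quasiMeasurePreserving_zpow h h' n
  have hgm : AEStronglyMeasurable g μ := (Lp.aestronglyMeasurable y).sub aestronglyMeasurable_const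
  have hV : ∀ B, ⇑(f ^ n) ⁻¹' B = img f (-n) B := fun B => by
    rw [img_eq_preimage, neg_neg]
  have hVm := hd.measurableSet_img (-n) hd.meas_W
  set D : ℝ≥0 := K * m / a (-n) with hD
  have hle : μ.restrict W ≤ (D : ℝ≥0∞) • (μ.restrict (img f (-n) W)).map (⇑(f ^ n)) := by
    refine Measure.le_iff.2 fun B hB => ?_
    rw [Measure.smul_apply, Measure.map_apply hn.measurable hB,
      Measure.restrict_apply (hn.measurable hB), Measure.restrict_apply hB, ← hV W,
      ← preimage_inter, hV, smul_eq_mul]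
    have h1 := (hbd (-n) (B ∩ W) (hB.inter hd.meas_W) inter_subset_right).1
    rw [one_div, ENNReal.inv_mul_le_iff (by exact_mod_cast hK0.ne') ENNReal.coe_ne_top, ha, hm] at h1
    rw [hD, ENNReal.coe_div (ha0 _).ne', ENNReal.mul_comm_div, ← mul_div_assoc,
      ENNReal.le_div_iff_mul_le (Or.inl (by exact_mod_cast (ha0 _).ne')) (Or.inl ENNReal.coe_ne_top)]
    calc μ (B ∩ W) * a (-n) = a (-n) * μ (B ∩ W) := mul_comm _ _
      _ ≤ _ := h1
      _ = _ := by push_cast; ring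
  have hb1 : eLpNorm (g ∘ ⇑(f ^ n)) p (μ.restrict (img f (-n) W)) ≤ 1 := by
    have hae : g ∘ ⇑(f ^ n) =ᵐ[μ.restrict (img f (-n) W)] ⇑((T ^ n) y - indicatorConstLp p
        hVm ((ha (-n)).trans_ne ENNReal.coe_ne_top) s) := by
      refine (ae_restrict_iff' hVm).2 ?_
      filter_upwards [Lp.coeFn_sub ((T ^ n) y) (indicatorConstLp p hVm
        ((ha (-n)).trans_ne ENNReal.coe_ne_top) s), hT.zpow h h' n y,
        indicatorConstLp_coeFn_mem (p := p) (hs := hVm)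
          (hμs := (ha (-n)).trans_ne ENNReal.coe_ne_top) (c := s)] with x h1 h2 h3 hx
      rw [h1, Pi.sub_apply, h2, h3 hx]
      rfl
    rw [eLpNorm_congr_ae hae]
    refine (eLpNorm_restrict_le _ _ _ _).trans ?_
    rw [← ENNReal.toReal_le_toReal (Lp.eLpNorm_ne_top _) ENNReal.one_ne_top, ← Lp.norm_def]
    simpa using hs
  have hb2 : eLpNorm g p (μ.restrict W) ≤ (D : ℝ≥0∞) ^ e := by
    refine (eLpNorm_mono_measure g hle).trans ((eLpNorm_smul_measure_le _ _ _ _).trans ?_)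
    have hac : (μ.restrict (img f (-n) W)).map (⇑(f ^ n)) ≪ μ :=
      (Measure.restrict_le_self.absolutelyContinuous.map hn.measurable).trans hn.absolutelyContinuous
    rw [eLpNorm_map_measure (hgm.mono_ac hac) hn.measurable.aemeasurable, he']
    exact mul_le_of_le_one_right' hb1
  have hb3 : ‖∫ x in W, g x ∂μ‖ₑ ≤ ((D ^ e * m ^ (1 - e) : ℝ≥0) : ℝ≥0∞) := by
    refine (enorm_integral_le_lintegral_enorm _).trans ?_
    rw [← eLpNorm_one_eq_lintegral_enorm]
    refine (eLpNorm_le_eLpNorm_mul_rpow_measure_univ hp1 hgm.restrict).trans ?_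
    rw [Measure.restrict_apply_univ, hm, ENNReal.coe_mul, ENNReal.coe_rpow_of_nonneg _ he0,
      ENNReal.coe_rpow_of_ne_zero hm0.ne', ENNReal.toReal_one, div_one]
    gcongr
  have hb4 : |∫ x in W, g x ∂μ| ≤ ((D ^ e * m ^ (1 - e) : ℝ≥0) : ℝ) := by
    rw [enorm_eq_nnnorm, ENNReal.coe_le_coe] at hb3
    exact_mod_cast hb3
  have hint : ∫ x in W, g x ∂μ = ∫ x in W, y x ∂μ - m * s := by
    rw [integral_sub (((Lp.memLp y).restrict W).integrable hp1) (integrable_const s)]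
    simp [Measure.real, hm]
  have hm0' : (0 : ℝ) < m := hm0
  have hae : (a (-n)) ^ (-e) = ((a (-n)) ^ e)⁻¹ := NNReal.rpow_neg _ _
  calc |s - (m : ℝ)⁻¹ * ∫ x in W, y x ∂μ| = |(m : ℝ)⁻¹ * -∫ x in W, g x ∂μ| := by
        rw [hint]
        congr 1
        field_simp
        ring
    _ = (m : ℝ)⁻¹ * |∫ x in W, g x ∂μ| := by
        rw [abs_mul, abs_neg, abs_of_pos (inv_pos.2 hm0')]
    _ ≤ (m : ℝ)⁻¹ * ((D ^ e * m ^ (1 - e) : ℝ≥0) : ℝ) := by gcongr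
    _ = ((m⁻¹ * ((K * m) ^ e * m ^ (1 - e)) : ℝ≥0) : ℝ) * ((a (-n)) ^ (-e) : ℝ≥0) := by
        rw [hD, NNReal.div_rpow, hae]
        push_cast
        ring
    _ = _ := by push_cast; rfl

theorem exists_expDecay_of_hasShadowing (hd : IsDissipative μ f W) {K : ℝ≥0} (hK0 : 0 < K)
    (hbd : BoundedDistortion μ f W K) (h : Measure.QuasiMeasurePreserving f μ μ)
    (h' : Measure.QuasiMeasurePreserving f.symm μ μ) {p : ℝ≥0∞} [Fact (1 ≤ p)] (hp : p ≠ ⊤)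
    {T : Lp ℝ p μ ≃L[ℝ] Lp ℝ p μ} (hT : RepsComp μ p f T) {a : ℤ → ℝ≥0}
    (ha : ∀ k, μ (img f k W) = a k) (ha0 : ∀ k, 0 < a k) (hsh : HasShadowing T) :
    ExpDecay a (-1) univ ∨ ExpDecay a 1 univ ∨
      ∃ k₁ k₂ : ℤ, ExpDecay a (-1) (Iic k₁) ∧ ExpDecay a 1 (Ici k₂) := by
  have hp1 : 1 ≤ p := Fact.out
  have hp0 : p ≠ 0 := (zero_lt_one.trans_le hp1).ne'
  have hq : 0 < p.toReal := ENNReal.toReal_pos hp0 hp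
  obtain ⟨L, hL, hLy⟩ := exists_average_bound hd hK0 hbd h h' hT ha ha0
  obtain ⟨δ, hδ, hsh⟩ := hsh 1 one_pos
  set e := 1 / p.toReal with he
  set w : ℤ → ℝ := fun n => δ * (a (-n) : ℝ) ^ (-e) with hw
  have ha0' : ∀ k, (0 : ℝ) < a k := fun k => ha0 k
  have hw0 : ∀ n, 0 < w n := fun n => mul_pos hδ (Real.rpow_pos_of_pos (ha0' _) _)
  obtain ⟨s, hs⟩ := exists_int_primitive fun n => w (n + 1)
  have hm : ∀ n, MeasurableSet (img f (-n) W) := fun n => hd.measurableSet_img (-n) hd.meas_W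
  have hfin : ∀ n, μ (img f (-n) W) ≠ ⊤ := fun n => (ha (-n)).trans_ne ENNReal.coe_ne_top
  set x : ℤ → Lp ℝ p μ := fun n => indicatorConstLp p (hm n) (hfin n) (s n) with hx
  have hTx : ∀ n, T (x n) - x (n + 1) =
      indicatorConstLp p (hm (n + 1)) (hfin (n + 1)) (s n - s (n + 1)) := fun n => by
    rw [← indicatorConstLp_sub]
    congr 1
    refine Lp.ext ((hT _).trans ?_)
    refine (h.ae_eq_comp indicatorConstLp_coeFn).trans (EventuallyEq.trans ?_
      indicatorConstLp_coeFn.symm)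
    refine Eventually.of_forall fun z => ?_
    have hpre : ⇑f ⁻¹' img f (-n) W = img f (-(n + 1)) W := by
      have := preimage_zpow_img f 1 (-n) W
      rwa [zpow_one, show -n - 1 = -(n + 1) by ring] at this
    rw [← hpre]
    rfl
  obtain ⟨y, hy⟩ := hsh x fun n => by
    rw [hTx, norm_indicatorConstLp hp0 hp, hs, sub_add_cancel_left, norm_neg, Real.norm_eq_abs,
      abs_of_pos (hw0 _), Measure.real, ha, ENNReal.coe_toReal, ← he, mul_assoc,
      ← Real.rpow_add (ha0' _), neg_add_cancel, Real.rpow_zero, mul_one]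
  obtain ⟨c, hc⟩ := hLy y
  obtain ⟨C, t, hC, ht, ht1, htri⟩ := primitive_trichotomy (r := fun n => s n - c) (w := w)
    (L := L / δ) (by positivity) hw0 (fun n => by rw [hs]; ring) fun n => by
      refine (hc n (s n) (hy n).le).trans_eq ?_
      simp only [hw]
      field_simp
  have hcancel : ∀ i j : ℤ, ∀ n : ℕ, w i ≤ C * t ^ n * w j →
      (a (-i) : ℝ) ^ (-e) ≤ C * t ^ n * (a (-j) : ℝ) ^ (-e) := fun i j n hij => by
    refine le_of_mul_le_mul_left ?_ hδ
    calc _ ≤ _ := hij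
      _ = _ := by simp only [hw]; ring
  have hback : ∀ (k : ℤ) (n : ℕ), w (-k) ≤ C * t ^ n * w (-k + n) →
      (a k : ℝ) ^ (-e) ≤ C * t ^ n * (a (k + -1 * n) : ℝ) ^ (-e) := fun k n hk => by
    have := hcancel _ _ n hk
    rwa [neg_neg, show -(-k + (n : ℤ)) = k + -1 * n by ring] at this
  have hfwd : ∀ (k : ℤ) (n : ℕ), w (-k) ≤ C * t ^ n * w (-k - n) →
      (a k : ℝ) ^ (-e) ≤ C * t ^ n * (a (k + 1 * n) : ℝ) ^ (-e) := fun k n hk => by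
    have := hcancel _ _ n hk
    rwa [neg_neg, show -(-k - (n : ℤ)) = k + 1 * n by ring] at this
  rcases htri with htri | htri | ⟨m₁, m₂, h₁, h₂⟩
  · exact Or.inl (.of_rpow ha0 hq hC ht ht1 fun n k _ => hback k n (htri _ n))
  · exact Or.inr (Or.inl (.of_rpow ha0 hq hC ht ht1 fun n k _ => hfwd k n (htri _ n)))
  · exact Or.inr (Or.inr ⟨-m₂, -m₁,
      .of_rpow ha0 hq hC ht ht1 fun n k hk => hback k n (h₂ _ (le_neg.1 hk) n),
      .of_rpow ha0 hq hC ht ht1 fun n k hk => hfwd k n (h₁ _ (neg_le.1 hk) n)⟩)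

theorem limsup_ratio_lt_one_iff {ι : Type*} {a : ℤ → ℝ≥0}
    (ha : ∀ k, μ (img f k W) = a k) (ha0 : ∀ k, 0 < a k) {σ : ℤ} {c : ℝ≥0}
    (hc : ∀ (n : ℕ) k, a (k + σ * n) ≤ c ^ n * a k) (κ : ι → ℤ) :
    limsup (fun n : ℕ => ⨆ i, (μ (img f (κ i + σ * n) W) / μ (img f (κ i) W)) ^ (1 / (n : ℝ)))
      atTop < 1 ↔ ExpDecay a σ (range κ) := by
  simp only [ha, ← ENNReal.coe_div (ha0 _).ne']
  rw [limsup_iSup_root_lt_one_iff _ c fun n i => (div_le_iff₀ (ha0 _)).2 (hc n _)]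
  simp only [div_le_iff₀ (ha0 _), ExpDecay, forall_mem_range]

theorem one_lt_liminf_ratio_iff {ι : Type*} {a : ℤ → ℝ≥0}
    (ha : ∀ k, μ (img f k W) = a k) (ha0 : ∀ k, 0 < a k) {d : ℝ≥0}
    (hd : ∀ (n : ℕ) k, a (k + 1 * n) ≤ d ^ n * a k) (κ : ι → ℤ) :
    1 < liminf (fun n : ℕ => ⨅ i, (μ (img f (κ i) W) / μ (img f (κ i + n) W)) ^ (1 / (n : ℝ)))
      atTop ↔ ExpDecay a 1 (range κ) := by
  have hinv : ∀ k l, (μ (img f k W) / μ (img f l W))⁻¹ = μ (img f l W) / μ (img f k W) :=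
    fun k l => by
      rw [ha, ha]
      exact ENNReal.inv_div (Or.inl ENNReal.coe_ne_top) (Or.inr (by exact_mod_cast (ha0 _).ne'))
  rw [one_lt_liminf_iInf_root_iff, ← limsup_ratio_lt_one_iff ha ha0 hd κ]
  simp only [hinv, one_mul]

theorem condHC_iff {a : ℤ → ℝ≥0} {c : ℝ≥0} (ha : ∀ k, μ (img f k W) = a k)
    (ha0 : ∀ k, 0 < a k) (hc : ∀ (n : ℕ) k, a (k + -1 * n) ≤ c ^ n * a k) :
    CondHC μ f W ↔ ExpDecay a (-1) univ := by
  have hshift : ∀ n : ℕ, (⨆ k : ℤ, (μ (img f k W) / μ (img f (k + n) W)) ^ (1 / (n : ℝ))) =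
      ⨆ k : ℤ, (μ (img f (id k + -1 * n) W) / μ (img f (id k) W)) ^ (1 / (n : ℝ)) := fun n => by
    rw [← (Equiv.addRight (n : ℤ)).iSup_comp (g := fun k : ℤ =>
      (μ (img f (id k + -1 * n) W) / μ (img f (id k) W)) ^ (1 / (n : ℝ)))]
    simp
  rw [← range_id, ← limsup_ratio_lt_one_iff ha ha0 hc id, CondHC]
  simp only [hshift]

theorem condHD_iff {a : ℤ → ℝ≥0} {d : ℝ≥0} (ha : ∀ k, μ (img f k W) = a k)
    (ha0 : ∀ k, 0 < a k) (hd : ∀ (n : ℕ) k, a (k + 1 * n) ≤ d ^ n * a k) :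
    CondHD μ f W ↔ ExpDecay a 1 univ := by
  rw [← range_id, ← one_lt_liminf_ratio_iff ha ha0 hd id]
  rfl

theorem condGH_iff {a : ℤ → ℝ≥0} {c d : ℝ≥0} (ha : ∀ k, μ (img f k W) = a k)
    (ha0 : ∀ k, 0 < a k) (hc : ∀ (n : ℕ) k, a (k + -1 * n) ≤ c ^ n * a k)
    (hd : ∀ (n : ℕ) k, a (k + 1 * n) ≤ d ^ n * a k) :
    CondGH μ f W ↔ ExpDecay a (-1) (Iic 0) ∧ ExpDecay a 1 (Ici 0) := by
  have hneg : range (fun m : ℕ => -(m : ℤ)) = Iic 0 := by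
    ext k
    refine ⟨?_, fun hk => ⟨k.natAbs, ?_⟩⟩
    · rintro ⟨m, rfl⟩
      simp
    · have : k ≤ 0 := hk
      dsimp only
      omega
  have hpos : range (fun m : ℕ => (m : ℤ)) = Ici 0 := by
    ext k
    refine ⟨?_, fun hk => ⟨k.natAbs, ?_⟩⟩
    · rintro ⟨m, rfl⟩
      simp
    · have : 0 ≤ k := hk
      dsimp only
      omega
  rw [← hneg, ← hpos, ← limsup_ratio_lt_one_iff ha ha0 hc, ← one_lt_liminf_ratio_iff ha ha0 hd,
    CondGH]
  simp only [neg_one_mul, ← sub_eq_add_neg]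

theorem exists_shift_bound {a : ℤ → ℝ≥0} {c d : ℝ≥0}
    (hc : ∀ (n : ℕ) k, a (k + -1 * n) ≤ c ^ n * a k)
    (hd : ∀ (n : ℕ) k, a (k + 1 * n) ≤ d ^ n * a k) (N : ℤ) :
    ∃ M : ℝ≥0, (∀ k, a k ≤ M * a (k + N)) ∧ ∀ k, a (k + N) ≤ M * a k := by
  have hle : ∀ (n : ℕ) k, a (k + -1 * n) ≤ (c ^ n + d ^ n) * a k ∧
      a (k + 1 * n) ≤ (c ^ n + d ^ n) * a k := fun n k =>
    ⟨(hc n k).trans (by gcongr; exact le_self_add), (hd n k).trans (by gcongr; exact le_add_self)⟩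
  obtain ⟨n, rfl | rfl⟩ := N.eq_nat_or_neg
  · refine ⟨c ^ n + d ^ n, fun k => ?_, fun k => ?_⟩
    · simpa using (hle n (k + n)).1
    · simpa using (hle n k).2
  · refine ⟨c ^ n + d ^ n, fun k => ?_, fun k => ?_⟩
    · simpa using (hle n (k + -n)).2
    · simpa using (hle n k).1

/-- Corollary SC, Shadowing Characterization: the composition operator
`T_f` has the shadowing property if and only if one of conditions 𝓗𝓒, 𝓗𝓓, 𝓖𝓗 holds. -/
theorem shadowing_iff_condHC_or_condHD_or_condGH
    {X : Type*} [MeasurableSpace X] (μ : Measure X) (f : Equiv.Perm X) (W : Set X)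
    (p : ℝ≥0∞) [Fact (1 ≤ p)] (hp : p ≠ ⊤)
    (hdiss : IsDissipative μ f W)
    (K : ℝ≥0∞) (hK0 : 0 < K) (hKfin : K ≠ ⊤)
    (hbd : BoundedDistortion μ f W K)
    (hstar : CondStar μ f) (hstar' : CondStar μ f.symm)
    (T : Lp ℝ p μ ≃L[ℝ] Lp ℝ p μ) (hT : RepsComp μ p f T) :
    HasShadowing T ↔ (CondHC μ f W ∨ CondHD μ f W ∨ CondGH μ f W) := by
  lift K to ℝ≥0 using hKfin
  replace hK0 : 0 < K := by exact_mod_cast hK0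
  have h := quasiMeasurePreserving_of_condStar hdiss.meas_f hstar
  have h' := quasiMeasurePreserving_of_condStar hdiss.meas_symm hstar'
  obtain ⟨c, -, hctop, hc⟩ := hstar
  obtain ⟨d, -, hdtop, hd⟩ := hstar'
  lift c to ℝ≥0 using hctop
  lift d to ℝ≥0 using hdtop
  have hWm : ∀ k, MeasurableSet (img f k W) := fun k => hdiss.measurableSet_img k hdiss.meas_W
  have hcb := condStar_bound (f := f) (σ := -1) (by simpa using hc) hWm
  have hdb := condStar_bound (f := f) (σ := 1) (c := d) hd hWm
  have hW0 : img f 0 W = W := by simp [img]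
  have hfin : ∀ k, μ (img f k W) ≠ ⊤ := fun k => by
    obtain ⟨n, rfl | rfl⟩ := k.eq_nat_or_neg
    · refine ne_top_of_le_ne_top ?_ (by simpa using hdb n 0)
      exact ENNReal.mul_ne_top (by finiteness) (by rw [hW0]; exact hdiss.fin.ne)
    · refine ne_top_of_le_ne_top ?_ (by simpa using hcb n 0)
      exact ENNReal.mul_ne_top (by finiteness) (by rw [hW0]; exact hdiss.fin.ne)
  obtain ⟨a, ha⟩ : ∃ a : ℤ → ℝ≥0, ∀ k, μ (img f k W) = a k :=
    ⟨fun k => (μ (img f k W)).toNNReal, fun k => (ENNReal.coe_toNNReal (hfin k)).symm⟩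
  have ha0 : ∀ k, 0 < a k := fun k => by
    refine pos_iff_ne_zero.2 fun h0 => hdiss.pos.ne' ?_
    have := (quasiMeasurePreserving_zpow h h' k).preimage_null (s := img f k W) (by simp [ha, h0])
    rwa [preimage_zpow_img, sub_self, hW0] at this
  replace hcb : ∀ (n : ℕ) k, a (k + -1 * n) ≤ c ^ n * a k := fun n k => by
    exact_mod_cast ha k ▸ ha (k + -1 * n) ▸ hcb n k
  replace hdb : ∀ (n : ℕ) k, a (k + 1 * n) ≤ d ^ n * a k := fun n k => by
    exact_mod_cast ha k ▸ ha (k + 1 * n) ▸ hdb n k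
  rw [condHC_iff ha ha0 hcb, condHD_iff ha ha0 hdb, condGH_iff ha ha0 hcb hdb]
  have hempty : ∀ σ, ExpDecay a σ ∅ := fun σ => ⟨0, 0, zero_lt_one, fun _ _ hk => hk.elim⟩
  constructor
  · intro hsh
    refine (exists_expDecay_of_hasShadowing hdiss hK0 hbd h h' hp hT ha ha0 hsh).imp_right
      (Or.imp_right ?_)
    rintro ⟨k₁, k₂, h₁, h₂⟩
    obtain ⟨M₁, hM₁, hM₁'⟩ := exists_shift_bound hcb hdb k₁
    obtain ⟨M₂, hM₂, hM₂'⟩ := exists_shift_bound hcb hdb k₂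
    refine ⟨h₁.of_shift (fun k hk => ?_) hM₁ hM₁', h₂.of_shift (fun k hk => ?_) hM₂ hM₂'⟩
    · simpa using hk
    · simpa using hk
  · rintro (h₁ | h₂ | ⟨h₁, h₂⟩)
    · exact hasShadowing_of_expDecay hdiss hK0 hbd h h' hp hT ha h₁ (by simpa using hempty 1)
    · exact hasShadowing_of_expDecay hdiss hK0 hbd h h' hp hT ha (hempty (-1)) (by simpa using h₂)
    · refine hasShadowing_of_expDecay hdiss hK0 hbd h h' hp hT ha h₁ (h₂.mono fun k hk => ?_)
      exact (notMem_Iic.1 hk).le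

end GHShadow
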